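/- Lower bound on the cumulative weight (intermediate claim in the proof of Theorem 1). Let μ, L > 0, let a be a real number with a ≥ 4L/μ, set α_t = (t+a)², A_t = Σ_{s=0}^t (s+a)², and γ = 2μa³. Then for every integer t ≥ 0, μA_t + 2γ − 2Lα_t ≥ μt³/3 + μa³. -/

import Mathlib

open Finset

theorem sum_range_succ_add_sq (a : ℝ) (t : ℕ) :
    ∑ s ∈ Finset.range (t + 1), ((s : ℝ) + a) ^ 2
      = (t : ℝ) * (t + 1) * (2 * t + 1) / 6 + a * t * (t + 1) + a ^ 2 * (t + 1) := by
  induction t with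
  | zero => simp
  | succ k ih =>
    rw [Finset.sum_range_succ, ih]
    push_cast
    ring

/-- Lower bound on the cumulative weight (intermediate claim in the proof of Theorem 1).
For `μ, L > 0`, `a ≥ 4L/μ`, `α_t = (t+a)²`, `A_t = ∑_{s=0}^t (s+a)²`, `γ = 2μa³`, and every
integer `t ≥ 0`, we have `μ A_t + 2γ - 2L α_t ≥ μ t³/3 + μ a³`. -/
theorem cumulative_weight_lower_bound (μ L a : ℝ) (hμ : 0 < μ) (hL : 0 < L)
    (ha : a ≥ 4 * L / μ) (t : ℕ) :
    μ * (∑ s ∈ Finset.range (t + 1), ((s : ℝ) + a) ^ 2) + 2 * (2 * μ * a ^ 3)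
        - 2 * L * ((t : ℝ) + a) ^ 2
      ≥ μ * (t : ℝ) ^ 3 / 3 + μ * a ^ 3 := by
  have ha_pos : 0 < a := lt_of_lt_of_le (by positivity) ha
  have hLa : 4 * L ≤ a * μ := (div_le_iff₀ hμ).mp ha
  have hα : 2 * L * ((t : ℝ) + a) ^ 2 ≤ μ * a / 2 * ((t : ℝ) + a) ^ 2 :=
    mul_le_mul_of_nonneg_right (by linarith) (sq_nonneg _)
  have hrem : 0 ≤ μ * ((t : ℝ) ^ 2 / 2 + t / 6 + a * t ^ 2 / 2 + a * t + a ^ 2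
      + 5 / 2 * a ^ 3) := by positivity
  rw [sum_range_succ_add_sq]
  linarith
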